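/- arXiv:2601.10760 — 2 statements merged into one kernel-verified Lean document; each statement's English description precedes it below -/
import Mathlib

section
/- For every integer n ≥ 2, −(7/4)(H_{n+1}/(n+1) − 1) < −(7/4)(H_n/n − 1); equivalently, the sequence H_n/n is strictly increasing in n for n ≥ 2. -/
open Real Finset

/-- `H n = ∑_{j=1}^{n-1} 1/(4 sin(π j / n))`. -/
noncomputable def Hfun (n : ℕ) : ℝ :=
  ∑ j ∈ Finset.Ico 1 n, 1 / (4 * Real.sin (π * j / n))

/-- The reciprocal of the sine is convex on `(0, π)`. -/
theorem convexOn_one_div_sin : ConvexOn ℝ (Set.Ioo 0 π) fun x => 1 / Real.sin x := by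
  refine ⟨convex_Ioo 0 π, fun x hx y hy a b ha hb hab => ?_⟩
  have hsx : 0 < Real.sin x := Real.sin_pos_of_mem_Ioo hx
  have hsy : 0 < Real.sin y := Real.sin_pos_of_mem_Ioo hy
  have hsin := strictConcaveOn_sin_Icc.concaveOn.2 (Set.Ioo_subset_Icc_self hx)
    (Set.Ioo_subset_Icc_self hy) ha hb hab
  simp only [smul_eq_mul] at hsin ⊢
  have hpos : 0 < a * Real.sin x + b * Real.sin y := by
    rcases ha.eq_or_lt with rfl | ha'
    · have : b = 1 := by linarith
      simpa [this] using hsy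
    · have := mul_pos ha' hsx
      have := mul_nonneg hb hsy.le
      linarith
  refine (one_div_le_one_div_of_le hpos hsin).trans ?_
  rw [mul_one_div, mul_one_div, div_add_div _ _ hsx.ne' hsy.ne',
    div_le_div_iff₀ hpos (mul_pos hsx hsy)]
  obtain rfl : b = 1 - a := by linarith
  nlinarith [mul_nonneg (mul_nonneg ha hb) (sq_nonneg (Real.sin x - Real.sin y))]

/-- A weighted sum of consecutive terms, rearranged into a plain sum plus a boundary term. -/
theorem sum_Ico_weighted_consecutive (g : ℕ → ℝ) (N : ℝ) {m : ℕ} (hm : 1 ≤ m) :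
    ∑ j ∈ Finset.Ico 1 m, ((N - j) * g j + j * g (j + 1)) =
      (N - 1) * ∑ j ∈ Finset.Ico 1 (m + 1), g j - (N - m) * g m := by
  induction m, hm using Nat.le_induction with
  | base => simp
  | succ m hm ih =>
    rw [Finset.sum_Ico_succ_top hm, ih, Finset.sum_Ico_succ_top (by omega : 1 ≤ m + 1)]
    push_cast
    ring

/-- For a convex function, the averages over the interior points of the uniform partitions of
an interval `[0, c]` are nondecreasing in the number of points. -/
theorem ConvexOn.mul_sum_Ico_le {f : ℝ → ℝ} {c : ℝ} (hc : 0 < c)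
    (hf : ConvexOn ℝ (Set.Ioo 0 c) f) {n : ℕ} (hn : 1 ≤ n) :
    n * ∑ j ∈ Finset.Ico 1 n, f (c * j / n) ≤
      (n - 1) * ∑ j ∈ Finset.Ico 1 (n + 1), f (c * j / (n + 1)) := by
  have hn0 : (0 : ℝ) < n := by exact_mod_cast hn
  have hmem : ∀ j : ℕ, 1 ≤ j → j ≤ n → c * j / (n + 1) ∈ Set.Ioo 0 c := fun j h1 h2 => by
    have h1' : (0 : ℝ) < j := by exact_mod_cast h1
    have h2' : (j : ℝ) ≤ n := by exact_mod_cast h2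
    refine ⟨by positivity, ?_⟩
    rw [div_lt_iff₀ (by positivity)]
    nlinarith
  have hsum := sum_Ico_weighted_consecutive (fun j => f (c * j / (n + 1))) n hn
  rw [sub_self, zero_mul, sub_zero] at hsum
  rw [← hsum, Finset.mul_sum]
  refine Finset.sum_le_sum fun j hj => ?_
  obtain ⟨h1, h2⟩ := Finset.mem_Ico.mp hj
  have h2' : (j : ℝ) ≤ n := by exact_mod_cast h2.le
  have key := hf.2 (hmem j h1 h2.le) (hmem (j + 1) (by omega) h2)
    (div_nonneg (sub_nonneg.2 h2') hn0.le) (div_nonneg j.cast_nonneg hn0.le)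
    (by field_simp; ring)
  have hpt : ((n - j : ℝ) / n) • (c * j / (n + 1)) +
      ((j : ℝ) / n) • (c * (j + 1 : ℕ) / (n + 1)) = c * j / n := by
    simp only [smul_eq_mul]
    push_cast
    field_simp
    ring
  rw [hpt] at key
  calc n * f (c * j / n) ≤ n * _ := mul_le_mul_of_nonneg_left key hn0.le
    _ = _ := by
      simp only [smul_eq_mul]
      field_simp

theorem Hfun_eq (n : ℕ) :
    Hfun n = (∑ j ∈ Finset.Ico 1 n, 1 / Real.sin (π * j / n)) / 4 := by
  rw [Hfun, Finset.sum_div]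
  exact Finset.sum_congr rfl fun j _ => by rw [div_div, mul_comm]

theorem Hfun_pos {n : ℕ} (hn : 2 ≤ n) : 0 < Hfun n := by
  refine Finset.sum_pos (fun j hj => ?_) ⟨1, Finset.mem_Ico.2 ⟨le_rfl, hn⟩⟩
  obtain ⟨h1, h2⟩ := Finset.mem_Ico.mp hj
  have h1' : (0 : ℝ) < j := by exact_mod_cast h1
  have h2' : (j : ℝ) < n := by exact_mod_cast h2
  have hn0 : (0 : ℝ) < n := h1'.trans h2'
  have : 0 < Real.sin (π * j / n) := by
    refine Real.sin_pos_of_pos_of_lt_pi (by positivity) ?_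
    rw [div_lt_iff₀ hn0]
    exact mul_lt_mul_of_pos_left h2' Real.pi_pos
  positivity

/-- `−(7/4)(H_{n+1}/(n+1) − 1) < −(7/4)(H_n/n − 1)` for all `n ≥ 2`;
equivalently `H_n / n` is strictly increasing for `n ≥ 2`. -/
theorem Hn_div_n_strictMono (n : ℕ) (hn : 2 ≤ n) :
    -(7 / 4) * (Hfun (n + 1) / (n + 1) - 1) < -(7 / 4) * (Hfun n / n - 1) := by
  have hn0 : (0 : ℝ) < n := by exact_mod_cast (by omega : 0 < n)
  have hle : n * Hfun n ≤ (n - 1) * Hfun (n + 1) := by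
    have h := convexOn_one_div_sin.mul_sum_Ico_le Real.pi_pos (by omega : 1 ≤ n)
    rw [Hfun_eq, Hfun_eq]
    push_cast
    linarith
  have hpos : 0 < Hfun (n + 1) := Hfun_pos (by omega)
  have hlt : Hfun n / n < Hfun (n + 1) / (n + 1) := by
    rw [div_lt_div_iff₀ hn0 (by positivity)]
    nlinarith
  linarith
end

section
/- For every integer n ≥ 24, −(7/4)(H_n/n − 1) < 9/4 − √2. -/
open Real Finset

theorem cos_le_quartic_of_nonneg {x : ℝ} (hx : 0 ≤ x) :
    cos x ≤ 1 - x ^ 2 / 2 + x ^ 4 / 24 := by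
  have hmono : MonotoneOn (fun y : ℝ => 1 - y ^ 2 / 2 + y ^ 4 / 24 - cos y) (Set.Ici 0) := by
    refine monotoneOn_of_hasDerivWithinAt_nonneg (f' := fun y => -y + y ^ 3 / 6 + sin y)
      (convex_Ici 0) (by fun_prop) (fun y _ => ?_) (fun y hy => ?_)
    · refine HasDerivAt.hasDerivWithinAt ?_
      refine ((((hasDerivAt_pow 2 y).div_const 2).const_sub 1).add
        ((hasDerivAt_pow 4 y).div_const 24) |>.sub (hasDerivAt_cos y)).congr_deriv ?_
      norm_num
      ring
    · have := sin_ge_sub_cube (interior_subset hy : y ∈ Set.Ici (0 : ℝ))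
      linarith
  have := hmono Set.self_mem_Ici hx hx
  simp at this
  linarith

theorem sin_le_quintic_of_nonneg {x : ℝ} (hx : 0 ≤ x) :
    sin x ≤ x - x ^ 3 / 6 + x ^ 5 / 120 := by
  have hmono : MonotoneOn (fun y : ℝ => y - y ^ 3 / 6 + y ^ 5 / 120 - sin y) (Set.Ici 0) := by
    refine monotoneOn_of_hasDerivWithinAt_nonneg
      (f' := fun y => 1 - y ^ 2 / 2 + y ^ 4 / 24 - cos y)
      (convex_Ici 0) (by fun_prop) (fun y _ => ?_) (fun y hy => ?_)
    · refine HasDerivAt.hasDerivWithinAt ?_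
      refine (((hasDerivAt_id y).sub ((hasDerivAt_pow 3 y).div_const 6)).add
        ((hasDerivAt_pow 5 y).div_const 120) |>.sub (hasDerivAt_sin y)).congr_deriv ?_
      norm_num
      ring
    · have := cos_le_quartic_of_nonneg (interior_subset hy : y ∈ Set.Ici (0 : ℝ))
      linarith
  have := hmono Set.self_mem_Ici hx hx
  simp at this
  linarith

theorem sin_pi_mul_le_of_le_half {x : ℝ} (hx : 0 ≤ x) (hx' : x ≤ 1 / 2) :
    sin (π * x) * (1 - x * (1 - x) + 2 / 5 * (x * (1 - x)) ^ 2) ≤ π * (x * (1 - x)) := by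
  have hpi := pi_gt_d4
  have hpi' := pi_lt_d4
  have hsin : sin (π * x) ≤ π * x * (1 - 9.86 * x ^ 2 / 6 + (9.86 * x ^ 2) ^ 2 / 120) := by
    refine (sin_le_quintic_of_nonneg (by positivity)).trans ?_
    have h₁ : 9.86 * x ^ 2 ≤ (π * x) ^ 2 := by
      rw [mul_pow]; gcongr; nlinarith
    have h₂ : (π * x) ^ 2 ≤ 10 := by
      have : π * x ≤ 3.1416 * (1 / 2) := by gcongr
      nlinarith [mul_nonneg pi_pos.le hx]
    have h₃ : 1 - (π * x) ^ 2 / 6 + ((π * x) ^ 2) ^ 2 / 120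
        ≤ 1 - 9.86 * x ^ 2 / 6 + (9.86 * x ^ 2) ^ 2 / 120 := by
      nlinarith
    nlinarith [mul_le_mul_of_nonneg_left h₃ (mul_nonneg pi_pos.le hx)]
  have hp : 0 ≤ 1 - x * (1 - x) + 2 / 5 * (x * (1 - x)) ^ 2 := by
    nlinarith [sq_nonneg (x * (1 - x)), sq_nonneg (x - 1 / 2)]
  refine (mul_le_mul_of_nonneg_right hsin hp).trans ?_
  have hpoly : (1 - 9.86 * x ^ 2 / 6 + (9.86 * x ^ 2) ^ 2 / 120)
      * (1 - x * (1 - x) + 2 / 5 * (x * (1 - x)) ^ 2) ≤ 1 - x := by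
    have hq : 0 ≤ (1.64 - 1.4) - (1.644 - 0.8) * x + 1.08 * x ^ 2 - 0.51 * x ^ 3
        - 0.48 * x ^ 4 + 0.48 * x ^ 5 := by
      nlinarith [pow_nonneg hx 2, pow_nonneg hx 3, mul_nonneg hx (sub_nonneg.2 hx'),
        mul_nonneg (pow_nonneg hx 2) (sub_nonneg.2 hx'),
        mul_nonneg (pow_nonneg hx 3) (sub_nonneg.2 hx'),
        mul_nonneg (pow_nonneg hx 4) (sub_nonneg.2 hx'),
        mul_nonneg hx (pow_nonneg (sub_nonneg.2 hx') 2),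
        mul_nonneg hx (pow_nonneg (sub_nonneg.2 hx') 3),
        mul_nonneg hx (pow_nonneg (sub_nonneg.2 hx') 4),
        mul_nonneg (pow_nonneg hx 2) (pow_nonneg (sub_nonneg.2 hx') 2),
        mul_nonneg (pow_nonneg hx 2) (pow_nonneg (sub_nonneg.2 hx') 3),
        mul_nonneg (pow_nonneg hx 3) (pow_nonneg (sub_nonneg.2 hx') 2),
        pow_nonneg (sub_nonneg.2 hx') 5, pow_nonneg (sub_nonneg.2 hx') 4]
    nlinarith [mul_nonneg (pow_nonneg hx 2) hq, pow_nonneg hx 3, pow_nonneg hx 4,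
      pow_nonneg hx 5, pow_nonneg hx 6, mul_nonneg (pow_nonneg hx 7) (sub_nonneg.2 hx')]
  calc _ = π * x * ((1 - 9.86 * x ^ 2 / 6 + (9.86 * x ^ 2) ^ 2 / 120)
      * (1 - x * (1 - x) + 2 / 5 * (x * (1 - x)) ^ 2)) := by ring
    _ ≤ π * x * (1 - x) := by gcongr
    _ = _ := by ring

theorem sin_pi_mul_le {x : ℝ} (hx : 0 ≤ x) (hx' : x ≤ 1) :
    sin (π * x) * (1 - x * (1 - x) + 2 / 5 * (x * (1 - x)) ^ 2) ≤ π * (x * (1 - x)) := by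
  rcases le_total x (1 / 2) with h | h
  · exact sin_pi_mul_le_of_le_half hx h
  · have := sin_pi_mul_le_of_le_half (x := 1 - x) (by linarith) (by linarith)
    rw [mul_sub, mul_one, sin_pi_sub] at this
    convert this using 2 <;> ring

theorem le_inv_four_mul_sin_pi_mul {x : ℝ} (hx : 0 < x) (hx' : x < 1) :
    (1 / x + 1 / (1 - x) - 1 + 2 / 5 * (x * (1 - x))) / (4 * π) ≤ 1 / (4 * sin (π * x)) := by
  have hs : 0 < sin (π * x) := sin_pos_of_pos_of_lt_pi (by positivity) (by nlinarith [pi_pos])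
  have h₁ : 0 < 1 - x := by linarith
  have hp : 0 < x * (1 - x) := by positivity
  have key := sin_pi_mul_le hx.le hx'.le
  have heq : 1 / x + 1 / (1 - x) - 1 + 2 / 5 * (x * (1 - x))
      = (1 - x * (1 - x) + 2 / 5 * (x * (1 - x)) ^ 2) / (x * (1 - x)) := by
    field_simp
    ring
  rw [heq, div_div, div_le_div_iff₀ (by positivity) (by positivity)]
  linarith

theorem sum_Ico_mul_sub (N : ℝ) (m : ℕ) (hm : 1 ≤ m) :
    ∑ j ∈ Ico 1 m, (j : ℝ) * (N - j) = N * (m * (m - 1) / 2) - (m - 1) * m * (2 * m - 1) / 6 := by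
  induction m, hm using Nat.le_induction with
  | base => simp
  | succ m hm ih =>
    rw [sum_Ico_succ_top hm, ih]
    push_cast
    ring

theorem sum_Ico_inv_sub (n : ℕ) :
    ∑ j ∈ Ico 1 n, 1 / ((n : ℝ) - j) = ∑ j ∈ Ico 1 n, 1 / (j : ℝ) := by
  refine sum_nbij' (fun j => n - j) (fun j => n - j) ?_ ?_ ?_ ?_ ?_
  all_goals intro j hj; rw [mem_Ico] at hj
  · rw [mem_Ico]; omega
  · rw [mem_Ico]; omega
  · omega
  · omega
  · rw [Nat.cast_sub hj.2.le]

theorem le_Hfun_div (n : ℕ) (hn : 1 ≤ n) :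
    (2 * ∑ j ∈ Ico 1 n, 1 / (j : ℝ) - 1 + 1 / n + (1 - 1 / (n : ℝ) ^ 2) / 15) / (4 * π)
      ≤ Hfun n / n := by
  have hn₀ : (0 : ℝ) < n := by exact_mod_cast hn
  have hterm : ∑ j ∈ Ico 1 n, (n * (1 / (j : ℝ)) + n * (1 / ((n : ℝ) - j)) - 1
      + 2 / 5 / (n : ℝ) ^ 2 * (j * (n - j))) / (4 * π) ≤ Hfun n := by
    refine sum_le_sum fun j hj => ?_
    rw [mem_Ico] at hj
    have hj₀ : (0 : ℝ) < j := by exact_mod_cast hj.1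
    have hj₁ : (j : ℝ) < n := by exact_mod_cast hj.2
    have h := le_inv_four_mul_sin_pi_mul (div_pos hj₀ hn₀) ((div_lt_one hn₀).2 hj₁)
    rw [← mul_div_assoc] at h
    refine le_trans (le_of_eq ?_) h
    have : (n : ℝ) - j ≠ 0 := by linarith
    have h' : 1 - (j : ℝ) / n = (n - j) / n := by field_simp
    rw [h']
    congr 1
    field_simp
  rw [← sum_div, sum_add_distrib, sum_sub_distrib, sum_add_distrib, ← mul_sum, ← mul_sum,
    ← mul_sum, sum_Ico_inv_sub, sum_Ico_mul_sub _ _ hn, sum_const, Nat.card_Ico, nsmul_eq_mul,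
    Nat.cast_sub hn] at hterm
  rw [le_div_iff₀ hn₀]
  refine le_trans (le_of_eq ?_) hterm
  rw [div_mul_eq_mul_div]
  congr 1
  push_cast
  field_simp
  ring

theorem le_harmonic_estimate (n : ℕ) (hn : 24 ≤ n) :
    (6.575 : ℝ) ≤ 2 * ∑ j ∈ Ico 1 n, 1 / (j : ℝ) - 1 + 1 / n + (1 - 1 / (n : ℝ) ^ 2) / 15 := by
  induction n, hn using Nat.le_induction with
  | base => norm_num [sum_Ico_succ_top]
  | succ n hn ih =>
    rw [sum_Ico_succ_top (by omega)]
    have hn₀ : (0 : ℝ) < n := by positivity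
    have h₁ : 1 / ((n + 1 : ℕ) : ℝ) ^ 2 ≤ 1 / (n : ℝ) ^ 2 := by gcongr; omega
    have h₂ : 0 < 1 / ((n + 1 : ℕ) : ℝ) := by positivity
    have h₃ : 0 < 1 / (n : ℝ) := by positivity
    linarith

/-- for every `n ≥ 24`, `−(7/4)(H_n/n − 1) < 9/4 − √2`. -/
theorem Hn_bound (n : ℕ) (hn : 24 ≤ n) :
    -(7 / 4) * (Hfun n / n - 1) < 9 / 4 - Real.sqrt 2 := by
  have h := le_Hfun_div n (by omega)
  have hB := le_harmonic_estimate n hn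
  have hsqrt : √2 < 1.41422 := by
    rw [sqrt_lt' (by norm_num)]; norm_num
  have hlow : (0.5231 : ℝ) ≤ Hfun n / n := by
    refine le_trans ?_ h
    rw [le_div_iff₀ (by positivity)]
    linarith [pi_lt_d4]
  linarith
end
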